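/- arXiv:2112.01212 — 7 statements merged into one kernel-verified Lean document; each statement's English description precedes it below -/
import Mathlib

section
/- Let V be a real inner product space of dimension n ≥ 4 and let R be an algebraic curvature tensor on V whose curvature operator of the second kind R̂ is two-positive. Then R satisfies the PIC1 condition: for every orthonormal 4-tuple (e₁,e₂,e₃,e₄) in V and every λ ∈ [0,1], R_{1313} + λ²R_{1414} + R_{2323} + λ²R_{2424} − 2λR_{1234} > 0. -/
open scoped BigOperators

noncomputable section

/-- The curvature operator of the second kind `R̂`, as a bilinear form on
(trace-free) symmetric two-tensors, expressed in components with respect to an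
orthonormal basis `b`:  `R̂(s,t) = ∑_{i,j,k,l} R_{iklj} s_{kl} t_{ij}`. -/
def secondKind {V : Type*} [NormedAddCommGroup V] [InnerProductSpace ℝ V] {n : ℕ}
    (R : V →ₗ[ℝ] V →ₗ[ℝ] V →ₗ[ℝ] V →ₗ[ℝ] ℝ)
    (b : OrthonormalBasis (Fin n) ℝ V)
    (s t : Matrix (Fin n) (Fin n) ℝ) : ℝ :=
  ∑ i, ∑ j, ∑ k, ∑ l, R (b i) (b k) (b l) (b j) * s k l * t i j

/-- `R` is an algebraic curvature tensor: it has the symmetries of a Riemannian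
curvature tensor and satisfies the first Bianchi identity. -/
def IsAlgCurv {V : Type*} [NormedAddCommGroup V] [InnerProductSpace ℝ V]
    (R : V →ₗ[ℝ] V →ₗ[ℝ] V →ₗ[ℝ] V →ₗ[ℝ] ℝ) : Prop :=
  (∀ x y z w, R x y z w = - R y x z w) ∧
  (∀ x y z w, R x y z w = - R x y w z) ∧
  (∀ x y z w, R x y z w = R z w x y) ∧
  (∀ x y z w, R x y z w + R x z w y + R x w y z = 0)

/-- `R̂` is `k`-positive: for every orthonormal basis and every `k` pairwise
orthogonal unit-norm trace-free symmetric two-tensors `h_1, …, h_k` (given by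
their component matrices), `∑ₐ R̂(hₐ,hₐ) > 0`. -/
def kPositiveSecondKind {V : Type*} [NormedAddCommGroup V] [InnerProductSpace ℝ V]
    (n k : ℕ) (R : V →ₗ[ℝ] V →ₗ[ℝ] V →ₗ[ℝ] V →ₗ[ℝ] ℝ) : Prop :=
  ∀ (b : OrthonormalBasis (Fin n) ℝ V) (h : Fin k → Matrix (Fin n) (Fin n) ℝ),
    (∀ a, (h a).IsSymm) →
    (∀ a, (h a).trace = 0) →
    (∀ a, ∑ i, ∑ j, h a i j * h a i j = 1) →
    (∀ a a', a ≠ a' → ∑ i, ∑ j, h a i j * h a' i j = 0) →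
    0 < ∑ a, secondKind R b (h a) (h a)

section SecondKindExpansion

variable {V : Type*} [NormedAddCommGroup V] [InnerProductSpace ℝ V] {n : ℕ}
  (R : V →ₗ[ℝ] V →ₗ[ℝ] V →ₗ[ℝ] V →ₗ[ℝ] ℝ) (b : OrthonormalBasis (Fin n) ℝ V)

lemma secondKind_add_left (s s' t : Matrix (Fin n) (Fin n) ℝ) :
    secondKind R b (s + s') t = secondKind R b s t + secondKind R b s' t := by
  simp only [secondKind, Matrix.add_apply, mul_add, add_mul, Finset.sum_add_distrib]

lemma secondKind_add_right (s t t' : Matrix (Fin n) (Fin n) ℝ) :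
    secondKind R b s (t + t') = secondKind R b s t + secondKind R b s t' := by
  simp only [secondKind, Matrix.add_apply, mul_add, Finset.sum_add_distrib]

lemma secondKind_single_single (p q r s : Fin n) (x y : ℝ) :
    secondKind R b (Matrix.single p q x) (Matrix.single r s y) =
      x * y * R (b r) (b p) (b q) (b s) := by
  unfold secondKind
  rw [Finset.sum_eq_single r, Finset.sum_eq_single s, Finset.sum_eq_single p,
    Finset.sum_eq_single q]
  · simp; ring
  all_goals simp +contextual [Matrix.single_apply, eq_comm]

lemma sum_single_mul (p q : Fin n) (x : ℝ) (M : Matrix (Fin n) (Fin n) ℝ) :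
    ∑ i, ∑ j, Matrix.single p q x i j * M i j = x * M p q := by
  rw [Finset.sum_eq_single p, Finset.sum_eq_single q]
  · simp
  all_goals simp +contextual [Matrix.single_apply, eq_comm]

lemma sum_add_mul (A B M : Matrix (Fin n) (Fin n) ℝ) :
    ∑ i, ∑ j, (A + B) i j * M i j = ∑ i, ∑ j, A i j * M i j + ∑ i, ∑ j, B i j * M i j := by
  simp only [Matrix.add_apply, add_mul, Finset.sum_add_distrib]

/-- The symmetric two-tensor `x (e_p ⊙ e_q) + y (e_r ⊙ e_s)`. -/
def symmPair (p q r s : Fin n) (x y : ℝ) : Matrix (Fin n) (Fin n) ℝ :=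
  Matrix.single p q x + Matrix.single q p x + (Matrix.single r s y + Matrix.single s r y)

lemma symmPair_isSymm (p q r s : Fin n) (x y : ℝ) : (symmPair p q r s x y).IsSymm := by
  simp only [Matrix.IsSymm, symmPair, Matrix.transpose_add, Matrix.transpose_single]
  abel

lemma symmPair_trace {p q r s : Fin n} (hpq : p ≠ q) (hrs : r ≠ s) (x y : ℝ) :
    (symmPair p q r s x y).trace = 0 := by
  simp [symmPair, Matrix.trace_add, Matrix.trace_single_eq_of_ne, hpq, hpq.symm, hrs, hrs.symm]

lemma sum_symmPair_mul (p q r s : Fin n) (x y : ℝ) (M : Matrix (Fin n) (Fin n) ℝ) :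
    ∑ i, ∑ j, symmPair p q r s x y i j * M i j =
      x * (M p q + M q p) + y * (M r s + M s r) := by
  simp only [symmPair, sum_add_mul, sum_single_mul]
  ring

/-- Real and imaginary parts of `(e_p + i e_q) ⊙ (e_r + i λ e_s)` form an orthogonal pair of
equal norm, and this is what two-positivity says about it. -/
lemma kPositiveSecondKind.pair_pos (hR : IsAlgCurv R) (hpos : kPositiveSecondKind n 2 R)
    {p q r s : Fin n} (hpq : p ≠ q) (hpr : p ≠ r) (hps : p ≠ s) (hqr : q ≠ r) (hqs : q ≠ s)
    (hrs : r ≠ s) (lam : ℝ) :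
    0 < R (b p) (b r) (b p) (b r) + lam ^ 2 * R (b p) (b s) (b p) (b s)
      + R (b q) (b r) (b q) (b r) + lam ^ 2 * R (b q) (b s) (b q) (b s)
      + 6 * lam * R (b p) (b q) (b r) (b s) := by
  obtain ⟨c, hc⟩ : ∃ c : ℝ, c ^ 2 * (2 * (1 + lam ^ 2)) = 1 := by
    have h0 : 0 < 2 * (1 + lam ^ 2) := by positivity
    refine ⟨√((2 * (1 + lam ^ 2))⁻¹), ?_⟩
    rw [Real.sq_sqrt (by positivity), inv_mul_cancel₀ h0.ne']
  have key := hpos b ![symmPair p r q s c (-(c * lam)), symmPair p s q r (c * lam) c] ?_ ?_ ?_ ?_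
  · obtain ⟨h1, h2, h3, h4⟩ := hR
    have hdiag : ∀ x z w, R x x z w = 0 := fun x z w => by linarith [h1 x x z w]
    have hsq : ∀ x y, R y x y x = R x y x y := fun x y => by
      rw [h1, h2, neg_neg]
    have hsymm : ∀ x y z w, R y x z w = -R x y z w ∧ R x y w z = -R x y z w ∧
        R y x w z = R x y z w ∧ R z w x y = R x y z w ∧ R w z x y = -R x y z w ∧
        R z w y x = -R x y z w ∧ R w z y x = R x y z w := fun x y z w => by
      refine ⟨?_, ?_, ?_, ?_, ?_, ?_, ?_⟩ <;>
      linarith [h1 x y z w, h2 x y z w, h1 x y w z, h3 x y z w, h3 x y w z, h3 y x z w,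
        h3 y x w z]
    have hsum : ∑ a, secondKind R b
        (![symmPair p r q s c (-(c * lam)), symmPair p s q r (c * lam) c] a)
        (![symmPair p r q s c (-(c * lam)), symmPair p s q r (c * lam) c] a) = 2 * c ^ 2 *
        (R (b p) (b r) (b p) (b r) + lam ^ 2 * R (b p) (b s) (b p) (b s)
          + R (b q) (b r) (b q) (b r) + lam ^ 2 * R (b q) (b s) (b q) (b s)
          + 6 * lam * R (b p) (b q) (b r) (b s)) := by
      simp only [Fin.sum_univ_two, Matrix.cons_val_zero, Matrix.cons_val_one, symmPair,
        secondKind_add_left, secondKind_add_right, secondKind_single_single, hdiag,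
        hsq (b p) (b r), hsq (b p) (b s), hsq (b q) (b r), hsq (b q) (b s)]
      have hX := hsymm (b p) (b q) (b r) (b s)
      have hZ := hsymm (b p) (b r) (b s) (b q)
      have hW := hsymm (b p) (b s) (b q) (b r)
      simp only [hX, hZ, hW]
      linear_combination (-4 * c ^ 2 * lam) * h4 (b p) (b q) (b r) (b s)
    rw [hsum] at key
    exact pos_of_mul_pos_right key (by positivity)
  · intro a
    fin_cases a <;> exact symmPair_isSymm ..
  · intro a
    fin_cases a <;> exact symmPair_trace ‹_› ‹_› ..
  · intro a
    fin_cases a <;>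
    · simp only [sum_symmPair_mul, Fin.zero_eta, Fin.mk_one, Matrix.cons_val_zero,
        Matrix.cons_val_one]
      simp [symmPair, hpq, hpr, hps, hqr, hqs, hrs, hpq.symm, hpr.symm,
        hps.symm, hqr.symm, hqs.symm, hrs.symm]
      linear_combination hc
  · intro a a' haa
    fin_cases a <;> fin_cases a' <;> first | exact absurd rfl haa | skip
    all_goals
      simp only [sum_symmPair_mul, Fin.zero_eta, Fin.mk_one, Matrix.cons_val_zero,
        Matrix.cons_val_one]
      simp [symmPair, hpq, hpr, hps, hqr, hqs, hrs, hpq.symm, hpr.symm,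
        hps.symm, hqr.symm, hqs.symm, hrs.symm]

end SecondKindExpansion

/-- If the curvature operator of the second kind of an algebraic curvature tensor on
an inner product space of dimension `n ≥ 4` is two-positive, then the PIC1 condition
holds. -/
theorem statement0 {V : Type*} [NormedAddCommGroup V] [InnerProductSpace ℝ V]
    [FiniteDimensional ℝ V] {n : ℕ} (hn : 4 ≤ n) (hdim : Module.finrank ℝ V = n)
    (R : V →ₗ[ℝ] V →ₗ[ℝ] V →ₗ[ℝ] V →ₗ[ℝ] ℝ)
    (hR : IsAlgCurv R)
    (hpos : kPositiveSecondKind n 2 R) :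
    ∀ e : Fin 4 → V, Orthonormal ℝ e → ∀ lam : ℝ, lam ∈ Set.Icc (0:ℝ) 1 →
      0 < R (e 0) (e 2) (e 0) (e 2) + lam ^ 2 * R (e 0) (e 3) (e 0) (e 3)
          + R (e 1) (e 2) (e 1) (e 2) + lam ^ 2 * R (e 1) (e 3) (e 1) (e 3)
          - 2 * lam * R (e 0) (e 1) (e 2) (e 3) := by
  intro e he lam _
  obtain ⟨b, hb⟩ := Orthonormal.exists_orthonormalBasis_extension_of_card_eq
    (𝕜 := ℝ) (E := V) (ι := Fin n) (by simpa using hdim)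
    (v := fun i => if h : i.val < 4 then e ⟨i, h⟩ else 0) (s := {i | i.val < 4}) (by
      have := he.comp (fun i : {i : Fin n | i.val < 4} => (⟨i.1.val, i.2⟩ : Fin 4))
        (fun i j hij => by
          apply Subtype.ext; apply Fin.ext; simpa using hij)
      convert this using 1
      funext i
      have hi : i.1.val < 4 := i.2
      simp [hi])
  have hbe : ∀ i : Fin 4, b (Fin.castLE hn i) = e i := fun i => by
    rw [hb _ (by simp)]
    simp
  have hne : ∀ i j : Fin 4, i ≠ j → Fin.castLE hn i ≠ Fin.castLE hn j :=
    fun i j hij h => hij (Fin.castLE_injective hn h)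
  have hP : ∀ μ : ℝ, _ := fun μ => hpos.pair_pos R b hR
    (hne 0 1 (by decide)) (hne 0 2 (by decide)) (hne 0 3 (by decide)) (hne 1 2 (by decide))
    (hne 1 3 (by decide)) (hne 2 3 (by decide)) μ
  simp only [hbe] at hP
  have h₁ := hP lam
  have h₂ := hP (-lam)
  linarith [neg_sq lam]
end
end

section
/- Let V be a real inner product space of dimension n ≥ 4 and let R be an algebraic curvature tensor on V whose curvature operator of the second kind R̂ is four-positive. Then R has positive isotropic curvature: for every orthonormal 4-tuple (e₁,e₂,e₃,e₄) in V, R_{1313} + R_{1414} + R_{2323} + R_{2424} − 2R_{1234} > 0. -/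
open scoped BigOperators

noncomputable section

/-- The extension by zero of a `4 × 4` matrix to a `(4 + m) × (4 + m)` matrix. -/
def extendZero {m : ℕ} (M : Matrix (Fin 4) (Fin 4) ℝ) : Matrix (Fin (4 + m)) (Fin (4 + m)) ℝ :=
  fun i j => Fin.addCases (fun p => Fin.addCases (M p) (fun _ => 0) j) (fun _ => 0) i

section ExtendZero

variable {m : ℕ} (M : Matrix (Fin 4) (Fin 4) ℝ)

@[simp] lemma extendZero_castAdd_castAdd (p q : Fin 4) :
    extendZero M (Fin.castAdd m p) (Fin.castAdd m q) = M p q := by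
  simp [extendZero]

@[simp] lemma extendZero_natAdd_left (p : Fin m) (j : Fin (4 + m)) :
    extendZero M (Fin.natAdd 4 p) j = 0 := by
  simp [extendZero]

@[simp] lemma extendZero_natAdd_right (i : Fin (4 + m)) (q : Fin m) :
    extendZero M i (Fin.natAdd 4 q) = 0 := by
  refine Fin.addCases (fun p => ?_) (fun p => ?_) i <;> simp [extendZero]

lemma extendZero_isSymm (hM : M.IsSymm) : (extendZero (m := m) M).IsSymm := by
  refine Matrix.IsSymm.ext fun i j => ?_
  refine Fin.addCases (fun p => ?_) (fun p => ?_) i <;>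
    refine Fin.addCases (fun q => ?_) (fun q => ?_) j <;> simp [hM.apply]

lemma trace_extendZero : (extendZero (m := m) M).trace = M.trace := by
  simp [Matrix.trace, Fin.sum_univ_add]

lemma sum_extendZero_mul (N : Matrix (Fin 4) (Fin 4) ℝ) :
    ∑ i, ∑ j, extendZero (m := m) M i j * extendZero N i j = ∑ p, ∑ q, M p q * N p q := by
  simp only [Fin.sum_univ_add, extendZero_castAdd_castAdd, extendZero_natAdd_left,
    extendZero_natAdd_right, mul_zero, Finset.sum_const_zero, add_zero]

lemma secondKind_extendZero {V : Type*} [NormedAddCommGroup V] [InnerProductSpace ℝ V]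
    (R : V →ₗ[ℝ] V →ₗ[ℝ] V →ₗ[ℝ] V →ₗ[ℝ] ℝ) (b : OrthonormalBasis (Fin (4 + m)) ℝ V)
    (N : Matrix (Fin 4) (Fin 4) ℝ) :
    secondKind R b (extendZero M) (extendZero N) =
      ∑ i, ∑ j, ∑ k, ∑ l, R (b (Fin.castAdd m i)) (b (Fin.castAdd m k)) (b (Fin.castAdd m l))
        (b (Fin.castAdd m j)) * M k l * N i j := by
  simp only [secondKind, Fin.sum_univ_add, extendZero_castAdd_castAdd, extendZero_natAdd_left,
    extendZero_natAdd_right, mul_zero, zero_mul, Finset.sum_const_zero, add_zero]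

end ExtendZero

/-- Every orthonormal 4-tuple in a space of dimension `4 + m` extends to an orthonormal basis. -/
lemma Orthonormal.exists_orthonormalBasis_castAdd {V : Type*} [NormedAddCommGroup V]
    [InnerProductSpace ℝ V] [FiniteDimensional ℝ V] {m : ℕ} (hdim : Module.finrank ℝ V = 4 + m)
    {e : Fin 4 → V} (he : Orthonormal ℝ e) :
    ∃ b : OrthonormalBasis (Fin (4 + m)) ℝ V, ∀ p, b (Fin.castAdd m p) = e p := by
  let v : Fin (4 + m) → V := Fin.addCases e fun _ => 0
  have hv : Orthonormal ℝ ((Set.range (Fin.castAdd m)).domRestrict v) := by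
    let f := Equiv.ofInjective (Fin.castAdd m (n := 4)) (Fin.castAdd_injective 4 m)
    convert he.comp f.symm f.symm.injective using 1
    funext x
    obtain ⟨p, rfl⟩ := f.surjective x
    simp [v, f]
  obtain ⟨b, hb⟩ := hv.exists_orthonormalBasis_extension_of_card_eq (by simpa using hdim)
  exact ⟨b, fun p => by simpa [v] using hb _ ⟨p, rfl⟩⟩

/-- Four-positivity of `R̂`, tested on trace-free symmetric two-tensors supported on the span of an
orthonormal 4-tuple. -/
lemma kPositiveSecondKind.sum_pos_of_orthonormal {V : Type*} [NormedAddCommGroup V]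
    [InnerProductSpace ℝ V] [FiniteDimensional ℝ V] {n : ℕ} (hn : 4 ≤ n)
    (hdim : Module.finrank ℝ V = n) {R : V →ₗ[ℝ] V →ₗ[ℝ] V →ₗ[ℝ] V →ₗ[ℝ] ℝ} {r : ℕ}
    (hpos : kPositiveSecondKind n r R) {e : Fin 4 → V} (he : Orthonormal ℝ e)
    (h : Fin r → Matrix (Fin 4) (Fin 4) ℝ) (hsymm : ∀ a, (h a).IsSymm)
    (htrace : ∀ a, (h a).trace = 0) (hnorm : ∀ a, ∑ i, ∑ j, h a i j * h a i j = 1)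
    (horth : ∀ a a', a ≠ a' → ∑ i, ∑ j, h a i j * h a' i j = 0) :
    0 < ∑ a, ∑ i, ∑ j, ∑ k, ∑ l, R (e i) (e k) (e l) (e j) * h a k l * h a i j := by
  obtain ⟨m, rfl⟩ := Nat.exists_eq_add_of_le hn
  obtain ⟨b, hb⟩ := he.exists_orthonormalBasis_castAdd hdim
  simpa only [secondKind_extendZero, hb] using hpos b (fun a => extendZero (h a))
    (fun a => extendZero_isSymm _ (hsymm a))
    (fun a => (trace_extendZero _).trans (htrace a))
    (fun a => (sum_extendZero_mul _ _).trans (hnorm a))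
    (fun a a' haa' => (sum_extendZero_mul _ _).trans (horth a a' haa'))

/-- Four orthonormal trace-free symmetric `4 × 4` matrices, depending on a sign `ε`. -/
def testTensor (ε : ℝ) : Fin 4 → Matrix (Fin 4) (Fin 4) ℝ :=
  ![!![1 / 2, 0, 0, 0; 0, 1 / 2, 0, 0; 0, 0, -1 / 2, 0; 0, 0, 0, -1 / 2],
    !![0, 0, 0, 1 / 2; 0, 0, -1 / 2, 0; 0, -1 / 2, 0, 0; 1 / 2, 0, 0, 0],
    !![0, 0, 1 / 2, 0; 0, 0, 0, 1 / 2; 1 / 2, 0, 0, 0; 0, 1 / 2, 0, 0],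
    !![0, 1 / 2, 0, 0; 1 / 2, 0, 0, 0; 0, 0, 0, ε / 2; 0, 0, ε / 2, 0]]

lemma three_mul_lt_of_kPositiveSecondKind {V : Type*} [NormedAddCommGroup V]
    [InnerProductSpace ℝ V] [FiniteDimensional ℝ V] {n : ℕ} (hn : 4 ≤ n)
    (hdim : Module.finrank ℝ V = n) {R : V →ₗ[ℝ] V →ₗ[ℝ] V →ₗ[ℝ] V →ₗ[ℝ] ℝ}
    (hR : IsAlgCurv R) (hpos : kPositiveSecondKind n 4 R) {e : Fin 4 → V}
    (he : Orthonormal ℝ e) :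
    3 * R (e 0) (e 1) (e 2) (e 3) <
      R (e 0) (e 2) (e 0) (e 2) + R (e 0) (e 3) (e 0) (e 3)
        + R (e 1) (e 2) (e 1) (e 2) + R (e 1) (e 3) (e 1) (e 3) := by
  obtain ⟨h₁, h₂, h₃, h₄⟩ := hR
  have key (ε : ℝ) (hε : ε * ε = 1) := hpos.sum_pos_of_orthonormal hn hdim he (testTensor ε)
    (fun a => by
      refine Matrix.IsSymm.ext fun i j => ?_
      fin_cases a <;> fin_cases i <;> fin_cases j <;> simp [testTensor])
    (fun a => by fin_cases a <;> simp [testTensor, Matrix.trace, Fin.sum_univ_four]; norm_num)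
    (fun a => by
      fin_cases a <;> simp [testTensor, Fin.sum_univ_four] <;> linarith)
    (fun a a' haa' => by
      fin_cases a <;> fin_cases a' <;> simp [testTensor, Fin.sum_univ_four] at haa' ⊢)
  have hp := key 1 (by norm_num)
  have hm := key (-1) (by norm_num)
  have diag (x z w : V) : R x x z w = 0 := by linarith [h₁ x x z w]
  have diag' (x z w : V) : R z w x x = 0 := by linarith [h₂ z w x x]
  simp [testTensor, Fin.sum_univ_four, diag, diag'] at hp hm
  have bianchi := h₄ (e 0) (e 1) (e 2) (e 3)
  simp only [h₁ (e 1) (e 0), h₁ (e 2) (e 0), h₁ (e 3) (e 0), h₁ (e 2) (e 1), h₁ (e 3) (e 1),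
    h₁ (e 3) (e 2), h₂ _ _ (e 1) (e 0), h₂ _ _ (e 2) (e 0), h₂ _ _ (e 3) (e 0),
    h₂ _ _ (e 2) (e 1), h₂ _ _ (e 3) (e 1), h₂ _ _ (e 3) (e 2), h₃ (e 2) (e 3) (e 0) (e 1),
    h₃ (e 1) (e 3) (e 0) (e 2), h₃ (e 1) (e 2) (e 0) (e 3)] at hp hm bianchi
  linarith

/-- If the curvature operator of the second kind of an algebraic curvature tensor on
an inner product space of dimension `n ≥ 4` is four-positive, then `R` has positive
isotropic curvature. -/
theorem statement2 {V : Type*} [NormedAddCommGroup V] [InnerProductSpace ℝ V]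
    [FiniteDimensional ℝ V] {n : ℕ} (hn : 4 ≤ n) (hdim : Module.finrank ℝ V = n)
    (R : V →ₗ[ℝ] V →ₗ[ℝ] V →ₗ[ℝ] V →ₗ[ℝ] ℝ)
    (hR : IsAlgCurv R)
    (hpos : kPositiveSecondKind n 4 R) :
    ∀ e : Fin 4 → V, Orthonormal ℝ e →
      0 < R (e 0) (e 2) (e 0) (e 2) + R (e 0) (e 3) (e 0) (e 3)
          + R (e 1) (e 2) (e 1) (e 2) + R (e 1) (e 3) (e 1) (e 3)
          - 2 * R (e 0) (e 1) (e 2) (e 3) := by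
  intro e he
  have h := three_mul_lt_of_kPositiveSecondKind hn hdim hR hpos he
  have h' := three_mul_lt_of_kPositiveSecondKind hn hdim hR hpos
    (he.comp _ (Equiv.swap (2 : Fin 4) 3).injective)
  simp [Equiv.swap_apply_of_ne_of_ne] at h'
  linarith [hR.2.1 (e 0) (e 1) (e 3) (e 2)]
end
end

section
/- Let V be a real inner product space of dimension n ≥ 4 and let R be an algebraic curvature tensor on V whose curvature operator of the second kind R̂ is four-non-negative. Then R has non-negative isotropic curvature: for every orthonormal 4-tuple (e₁,e₂,e₃,e₄) in V, R_{1313} + R_{1414} + R_{2323} + R_{2424} − 2R_{1234} ≥ 0. -/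
open scoped BigOperators

noncomputable section

/-- `R̂` is `k`-non-negative: for every orthonormal basis and every `k` pairwise
orthogonal unit-norm trace-free symmetric two-tensors `h_1, …, h_k` (given by
their component matrices), `∑ₐ R̂(hₐ,hₐ) ≥ 0`. -/
def kNonNegSecondKind {V : Type*} [NormedAddCommGroup V] [InnerProductSpace ℝ V]
    (n k : ℕ) (R : V →ₗ[ℝ] V →ₗ[ℝ] V →ₗ[ℝ] V →ₗ[ℝ] ℝ) : Prop :=
  ∀ (b : OrthonormalBasis (Fin n) ℝ V) (h : Fin k → Matrix (Fin n) (Fin n) ℝ),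
    (∀ a, (h a).IsSymm) →
    (∀ a, (h a).trace = 0) →
    (∀ a, ∑ i, ∑ j, h a i j * h a i j = 1) →
    (∀ a a', a ≠ a' → ∑ i, ∑ j, h a i j * h a' i j = 0) →
    0 ≤ ∑ a, secondKind R b (h a) (h a)

/-- The extension by zero of a `4 × 4` matrix to an `n × n` matrix along `Fin.castLE`. -/
def extendByZero (n : ℕ) (m : Matrix (Fin 4) (Fin 4) ℝ) : Matrix (Fin n) (Fin n) ℝ :=
  fun i j => if h : (i : ℕ) < 4 ∧ (j : ℕ) < 4 then m ⟨i, h.1⟩ ⟨j, h.2⟩ else 0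

theorem extendByZero_castLE {n : ℕ} (hn : 4 ≤ n) (m : Matrix (Fin 4) (Fin 4) ℝ) (p q : Fin 4) :
    extendByZero n m (Fin.castLE hn p) (Fin.castLE hn q) = m p q := by
  simp [extendByZero]

theorem extendByZero_of_row_ge {n : ℕ} (m : Matrix (Fin 4) (Fin 4) ℝ) {i : Fin n}
    (hi : 4 ≤ (i : ℕ)) (j : Fin n) : extendByZero n m i j = 0 :=
  dif_neg fun h => absurd h.1 (by omega)

theorem extendByZero_of_col_ge {n : ℕ} (m : Matrix (Fin 4) (Fin 4) ℝ) (i : Fin n) {j : Fin n}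
    (hj : 4 ≤ (j : ℕ)) : extendByZero n m i j = 0 :=
  dif_neg fun h => absurd h.2 (by omega)

theorem sum_eq_sum_castLE {n : ℕ} (hn : 4 ≤ n) (f : Fin n → ℝ)
    (hf : ∀ i : Fin n, 4 ≤ (i : ℕ) → f i = 0) :
    ∑ i, f i = ∑ p : Fin 4, f (Fin.castLE hn p) := by
  refine (Fintype.sum_of_injective (Fin.castLE hn) (Fin.castLE_injective hn) _ _ ?_
    fun _ => rfl).symm
  intro i hi
  refine hf i (not_lt.1 fun h => hi ⟨⟨i, h⟩, rfl⟩)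

theorem sum_sum_extendByZero_mul {n : ℕ} (hn : 4 ≤ n) (m : Matrix (Fin 4) (Fin 4) ℝ)
    (f : Fin n → Fin n → ℝ) :
    ∑ i, ∑ j, extendByZero n m i j * f i j =
      ∑ p, ∑ q, m p q * f (Fin.castLE hn p) (Fin.castLE hn q) := by
  rw [sum_eq_sum_castLE hn]
  · refine Finset.sum_congr rfl fun p _ => ?_
    rw [sum_eq_sum_castLE hn]
    · simp only [extendByZero_castLE]
    · intro j hj
      rw [extendByZero_of_col_ge m _ hj, zero_mul]
  · intro i hi
    simp only [extendByZero_of_row_ge m hi, zero_mul, Finset.sum_const_zero]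

theorem secondKind_extendByZero {V : Type*} [NormedAddCommGroup V] [InnerProductSpace ℝ V]
    {n : ℕ} (hn : 4 ≤ n) (R : V →ₗ[ℝ] V →ₗ[ℝ] V →ₗ[ℝ] V →ₗ[ℝ] ℝ)
    (b : OrthonormalBasis (Fin n) ℝ V) (s t : Matrix (Fin 4) (Fin 4) ℝ) :
    secondKind R b (extendByZero n s) (extendByZero n t) =
      ∑ i, ∑ j, t i j * ∑ k, ∑ l, s k l *
        R (b (Fin.castLE hn i)) (b (Fin.castLE hn k)) (b (Fin.castLE hn l))
          (b (Fin.castLE hn j)) := by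
  have h : secondKind R b (extendByZero n s) (extendByZero n t) =
      ∑ i, ∑ j, extendByZero n t i j * ∑ k, ∑ l, extendByZero n s k l *
        R (b i) (b k) (b l) (b j) := by
    simp only [secondKind, Finset.mul_sum]
    refine Finset.sum_congr rfl fun i _ => Finset.sum_congr rfl fun j _ =>
      Finset.sum_congr rfl fun k _ => Finset.sum_congr rfl fun l _ => by ring
  simp only [h, sum_sum_extendByZero_mul hn]

/-- An orthonormal 4-tuple extends to an orthonormal basis indexed by `Fin n`. -/
theorem exists_orthonormalBasis_castLE_eq {V : Type*} [NormedAddCommGroup V]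
    [InnerProductSpace ℝ V] [FiniteDimensional ℝ V] {n : ℕ} (hn : 4 ≤ n)
    (hdim : Module.finrank ℝ V = n) {e : Fin 4 → V} (he : Orthonormal ℝ e) :
    ∃ b : OrthonormalBasis (Fin n) ℝ V, ∀ p, b (Fin.castLE hn p) = e p := by
  let v : Fin n → V := fun i => if h : (i : ℕ) < 4 then e ⟨i, h⟩ else 0
  have hv : Orthonormal ℝ (({i : Fin n | (i : ℕ) < 4} : Set (Fin n)).domRestrict v) := by
    have : ({i : Fin n | (i : ℕ) < 4} : Set (Fin n)).domRestrict v =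
        e ∘ fun i : {i : Fin n // (i : ℕ) < 4} => ⟨i, i.2⟩ := by
      funext i
      exact dif_pos i.2
    rw [this]
    refine he.comp _ fun i j hij => ?_
    exact Subtype.ext (Fin.ext (congrArg (fun p : Fin 4 => (p : ℕ)) hij))
  obtain ⟨b, hb⟩ := hv.exists_orthonormalBasis_extension_of_card_eq (by simpa using hdim)
  refine ⟨b, fun p => ?_⟩
  rw [hb _ (by simp)]
  simp [v]

/-- `k`-non-negativity may be tested on orthonormal trace-free symmetric tensors supported on
the span of an orthonormal 4-tuple. -/
theorem kNonNegSecondKind.sum_nonneg_of_orthonormal {V : Type*} [NormedAddCommGroup V]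
    [InnerProductSpace ℝ V] [FiniteDimensional ℝ V] {n k : ℕ} (hn : 4 ≤ n)
    (hdim : Module.finrank ℝ V = n) {R : V →ₗ[ℝ] V →ₗ[ℝ] V →ₗ[ℝ] V →ₗ[ℝ] ℝ}
    (hnn : kNonNegSecondKind n k R) {e : Fin 4 → V} (he : Orthonormal ℝ e)
    (m : Fin k → Matrix (Fin 4) (Fin 4) ℝ) (hsymm : ∀ a, (m a).IsSymm)
    (htr : ∀ a, (m a).trace = 0) (hnorm : ∀ a, ∑ i, ∑ j, m a i j * m a i j = 1)
    (horth : ∀ a a', a ≠ a' → ∑ i, ∑ j, m a i j * m a' i j = 0) :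
    0 ≤ ∑ a, ∑ i, ∑ j, m a i j * ∑ k, ∑ l, m a k l * R (e i) (e k) (e l) (e j) := by
  obtain ⟨b, hb⟩ := exists_orthonormalBasis_castLE_eq hn hdim he
  have key := hnn b (fun a => extendByZero n (m a)) ?_ ?_ ?_ ?_
  · simpa only [secondKind_extendByZero hn, hb] using key
  · refine fun a => Matrix.IsSymm.ext fun i j => ?_
    simp only [extendByZero, and_comm (a := (j : ℕ) < 4)]
    split_ifs
    · exact (hsymm a).apply _ _
    · rfl
  · intro a
    rw [Matrix.trace, sum_eq_sum_castLE hn]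
    · simpa only [Matrix.diag_apply, extendByZero_castLE, Matrix.trace] using htr a
    · exact fun i hi => extendByZero_of_row_ge _ hi _
  · intro a
    refine (sum_sum_extendByZero_mul hn _ _).trans ?_
    simpa only [extendByZero_castLE] using hnorm a
  · intro a a' haa'
    refine (sum_sum_extendByZero_mul hn _ _).trans ?_
    simpa only [extendByZero_castLE] using horth a a' haa'

/-- Four trace-free symmetric tensors on `ℝ⁴`, depending on two signs `σ` and `τ`. -/
def testTensors (σ τ : ℝ) : Fin 4 → Matrix (Fin 4) (Fin 4) ℝ :=
  ![!![1/2, 0, 0, 0; 0, 1/2, 0, 0; 0, 0, -1/2, 0; 0, 0, 0, -1/2],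
    !![0, 0, 1/2, 0; 0, 0, 0, σ/2; 1/2, 0, 0, 0; 0, σ/2, 0, 0],
    !![0, 0, 0, 1/2; 0, 0, -σ/2, 0; 0, -σ/2, 0, 0; 1/2, 0, 0, 0],
    !![0, 1/2, 0, 0; 1/2, 0, 0, 0; 0, 0, 0, τ/2; 0, 0, τ/2, 0]]

/-- Four-non-negativity evaluated on `testTensors σ τ`. -/
theorem kNonNegSecondKind.add_nonneg_of_sign {V : Type*} [NormedAddCommGroup V]
    [InnerProductSpace ℝ V] [FiniteDimensional ℝ V] {n : ℕ} (hn : 4 ≤ n)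
    (hdim : Module.finrank ℝ V = n) {R : V →ₗ[ℝ] V →ₗ[ℝ] V →ₗ[ℝ] V →ₗ[ℝ] ℝ}
    (hR : IsAlgCurv R) (hnn : kNonNegSecondKind n 4 R) {e : Fin 4 → V} (he : Orthonormal ℝ e)
    {σ τ : ℝ} (hσ : σ ^ 2 = 1) (hτ : τ ^ 2 = 1) :
    0 ≤ R (e 0) (e 2) (e 0) (e 2) + R (e 0) (e 3) (e 0) (e 3)
      + R (e 1) (e 2) (e 1) (e 2) + R (e 1) (e 3) (e 1) (e 3)
      - 3 * σ * R (e 0) (e 1) (e 2) (e 3)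
      + τ * (R (e 0) (e 2) (e 3) (e 1) + R (e 0) (e 3) (e 2) (e 1)) := by
  obtain ⟨h1, h2, h3, h4⟩ := hR
  have key := hnn.sum_nonneg_of_orthonormal hn hdim he (testTensors σ τ) ?_ ?_ ?_ ?_
  · have hz : ∀ x z w, R x x z w = 0 := fun x z w => by linarith [h1 x x z w]
    have hz' : ∀ x y z, R x y z z = 0 := fun x y z => by linarith [h2 x y z z]
    simp only [testTensors, Fin.sum_univ_four, Matrix.of_apply, Matrix.cons_val', Matrix.cons_val,
      zero_mul, add_zero, zero_add, mul_zero, hz, hz'] at key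
    have bianchi := h4 (e 0) (e 1) (e 2) (e 3)
    simp only [h1 (e 1) (e 0), h1 (e 2) (e 0), h1 (e 3) (e 0), h1 (e 2) (e 1),
      h1 (e 3) (e 1), h1 (e 3) (e 2),
      h2 _ _ (e 1) (e 0), h2 _ _ (e 2) (e 0), h2 _ _ (e 3) (e 0), h2 _ _ (e 2) (e 1),
      h2 _ _ (e 3) (e 1), h2 _ _ (e 3) (e 2),
      h3 (e 2) (e 3) (e 0) (e 1), h3 (e 1) (e 3) (e 0) (e 2), h3 (e 1) (e 2) (e 0) (e 3)]
      at key bianchi ⊢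
    rcases sq_eq_one_iff.1 hσ with rfl | rfl <;>
      rcases sq_eq_one_iff.1 hτ with rfl | rfl <;> linarith
  · intro a
    ext i j
    fin_cases a <;> fin_cases i <;> fin_cases j <;> simp [testTensors]
  · intro a
    fin_cases a <;> simp [testTensors, Matrix.trace, Fin.sum_univ_four]
    ring
  · intro a
    fin_cases a <;> (simp [testTensors, Fin.sum_univ_four]; linarith)
  · intro a a' h
    fin_cases a <;> fin_cases a' <;> simp [testTensors, Fin.sum_univ_four] at h ⊢

/-- If the curvature operator of the second kind of an algebraic curvature tensor on
an inner product space of dimension `n ≥ 4` is four-non-negative, then `R` has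
non-negative isotropic curvature. -/
theorem statement3 {V : Type*} [NormedAddCommGroup V] [InnerProductSpace ℝ V]
    [FiniteDimensional ℝ V] {n : ℕ} (hn : 4 ≤ n) (hdim : Module.finrank ℝ V = n)
    (R : V →ₗ[ℝ] V →ₗ[ℝ] V →ₗ[ℝ] V →ₗ[ℝ] ℝ)
    (hR : IsAlgCurv R)
    (hnn : kNonNegSecondKind n 4 R) :
    ∀ e : Fin 4 → V, Orthonormal ℝ e →
      0 ≤ R (e 0) (e 2) (e 0) (e 2) + R (e 0) (e 3) (e 0) (e 3)
          + R (e 1) (e 2) (e 1) (e 2) + R (e 1) (e 3) (e 1) (e 3)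
          - 2 * R (e 0) (e 1) (e 2) (e 3) := by
  intro e he
  have h₁ := hnn.add_nonneg_of_sign hn hdim hR he (σ := 1) (τ := 1) (by norm_num) (by norm_num)
  have h₂ := hnn.add_nonneg_of_sign hn hdim hR he (σ := 1) (τ := -1) (by norm_num) (by norm_num)
  have h₃ := hnn.add_nonneg_of_sign hn hdim hR he (σ := -1) (τ := 1) (by norm_num) (by norm_num)
  have h₄ := hnn.add_nonneg_of_sign hn hdim hR he (σ := -1) (τ := -1) (by norm_num) (by norm_num)
  linarith
end
end

section
/- Let V be a real inner product space of dimension n ≥ 4 and let R be an algebraic curvature tensor on V whose curvature operator of the second kind R̂ is four-positive. Then for every orthonormal 4-tuple (e₁,e₂,e₃,e₄) in V, R_{1414} + R_{2323} > 0. -/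
open scoped BigOperators

noncomputable section

/-- The matrix on `κ` obtained from a matrix on `ι` by pushing its entries forward along `f`. -/
def pushMatrix {ι κ : Type*} [Fintype ι] [DecidableEq κ] (f : ι → κ) (H : Matrix ι ι ℝ) :
    Matrix κ κ ℝ :=
  Matrix.of fun i j => ∑ p, ∑ q, if f p = i then if f q = j then H p q else 0 else 0

theorem sum_mul_pushMatrix {ι κ : Type*} [Fintype ι] [Fintype κ] [DecidableEq κ] (f : ι → κ)
    (H : Matrix ι ι ℝ) (F : κ → κ → ℝ) :
    ∑ i, ∑ j, F i j * pushMatrix f H i j = ∑ p, ∑ q, F (f p) (f q) * H p q := by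
  simp only [pushMatrix, Matrix.of_apply, Finset.mul_sum]
  calc _ = ∑ i, ∑ p, ∑ q, ∑ j,
        F i j * (if f p = i then if f q = j then H p q else 0 else 0) := by
        refine Finset.sum_congr rfl fun i _ => ?_
        rw [Finset.sum_comm]
        exact Finset.sum_congr rfl fun p _ => Finset.sum_comm
    _ = ∑ p, ∑ q, ∑ i, ∑ j,
        F i j * (if f p = i then if f q = j then H p q else 0 else 0) := by
        rw [Finset.sum_comm]
        exact Finset.sum_congr rfl fun p _ => Finset.sum_comm
    _ = _ := by simp

theorem pushMatrix_apply_apply {ι κ : Type*} [Fintype ι] [DecidableEq κ] {f : ι → κ}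
    (hf : Function.Injective f) (H : Matrix ι ι ℝ) (p q : ι) :
    pushMatrix f H (f p) (f q) = H p q := by
  classical
  simp [pushMatrix, hf.eq_iff]

theorem isSymm_pushMatrix {ι κ : Type*} [Fintype ι] [DecidableEq κ] (f : ι → κ)
    {H : Matrix ι ι ℝ} (hH : H.IsSymm) : (pushMatrix f H).IsSymm := by
  ext i j
  simp only [Matrix.transpose_apply, pushMatrix, Matrix.of_apply]
  rw [Finset.sum_comm]
  refine Finset.sum_congr rfl fun p _ => Finset.sum_congr rfl fun q _ => ?_
  rw [hH.apply]
  split_ifs <;> rfl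

theorem trace_pushMatrix {ι κ : Type*} [Fintype ι] [Fintype κ] [DecidableEq κ] {f : ι → κ}
    (hf : Function.Injective f) (H : Matrix ι ι ℝ) : (pushMatrix f H).trace = H.trace := by
  classical
  have h := sum_mul_pushMatrix f H (fun i j => if i = j then 1 else 0)
  simpa [hf.eq_iff, Matrix.trace] using h

theorem sum_pushMatrix_mul_pushMatrix {ι κ : Type*} [Fintype ι] [Fintype κ] [DecidableEq κ]
    {f : ι → κ} (hf : Function.Injective f) (H K : Matrix ι ι ℝ) :
    ∑ i, ∑ j, pushMatrix f H i j * pushMatrix f K i j = ∑ p, ∑ q, H p q * K p q := by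
  rw [sum_mul_pushMatrix f K fun i j => pushMatrix f H i j]
  simp only [pushMatrix_apply_apply hf]

theorem secondKind_pushMatrix {V : Type*} [NormedAddCommGroup V] [InnerProductSpace ℝ V] {n : ℕ}
    (R : V →ₗ[ℝ] V →ₗ[ℝ] V →ₗ[ℝ] V →ₗ[ℝ] ℝ) (b : OrthonormalBasis (Fin n) ℝ V)
    {ι : Type*} [Fintype ι] (f : ι → Fin n) (H K : Matrix ι ι ℝ) :
    secondKind R b (pushMatrix f H) (pushMatrix f K) =
      ∑ p, ∑ q, (∑ r, ∑ s, R (b (f p)) (b (f r)) (b (f s)) (b (f q)) * H r s) * K p q := by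
  simp only [secondKind, ← Finset.sum_mul]
  simp only [sum_mul_pushMatrix f K, sum_mul_pushMatrix f H]

/-- An orthonormal 4-tuple extends to an orthonormal basis. -/
theorem exists_orthonormalBasis_castLE {V : Type*} [NormedAddCommGroup V]
    [InnerProductSpace ℝ V] [FiniteDimensional ℝ V] {m n : ℕ} (hmn : m ≤ n)
    (hdim : Module.finrank ℝ V = n) {e : Fin m → V} (he : Orthonormal ℝ e) :
    ∃ b : OrthonormalBasis (Fin n) ℝ V, ∀ p, b (Fin.castLE hmn p) = e p := by
  have hv : Orthonormal ℝ (Set.domRestrict {i : Fin n | i.1 < m}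
      (fun i => if h : i.1 < m then e ⟨i, h⟩ else 0)) := by
    convert he.comp (fun i : {i : Fin n | i.1 < m} => (⟨i.1, i.2⟩ : Fin m)) ?_ using 1
    · ext i
      have hi : i.1.1 < m := i.2
      simp [Set.domRestrict, hi]
    · intro i j hij
      ext
      simpa using hij
  obtain ⟨b, hb⟩ := hv.exists_orthonormalBasis_extension_of_card_eq (by simpa using hdim)
  refine ⟨b, fun p => ?_⟩
  rw [hb _ (by simp)]
  simp

/-- Four orthonormal trace-free symmetric forms on `ℝ⁴`, on which the sum of `R̂` equals
`2 (R₁₄₁₄ + R₂₃₂₃)`. -/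
def testForms : Fin 4 → Matrix (Fin 4) (Fin 4) ℝ :=
  ![Matrix.diagonal ![1 / 2, 1 / 2, -1 / 2, -1 / 2],
    Matrix.diagonal ![1 / 2, -1 / 2, 1 / 2, -1 / 2],
    !![0, 0, 0, 1 / 2; 0, 0, 1 / 2, 0; 0, 1 / 2, 0, 0; 1 / 2, 0, 0, 0],
    !![0, 0, 0, 1 / 2; 0, 0, -1 / 2, 0; 0, -1 / 2, 0, 0; 1 / 2, 0, 0, 0]]

theorem sum_testForms {V : Type*} [NormedAddCommGroup V] [InnerProductSpace ℝ V]
    {R : V →ₗ[ℝ] V →ₗ[ℝ] V →ₗ[ℝ] V →ₗ[ℝ] ℝ} (hR : IsAlgCurv R) (e : Fin 4 → V) :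
    ∑ a, ∑ p, ∑ q, (∑ r, ∑ s, R (e p) (e r) (e s) (e q) * testForms a r s) * testForms a p q =
      2 * (R (e 0) (e 3) (e 0) (e 3) + R (e 1) (e 2) (e 1) (e 2)) := by
  obtain ⟨h1, h2, h3, -⟩ := hR
  have hz : ∀ x z w, R x x z w = 0 := fun x z w => by linarith [h1 x x z w]
  have hs : ∀ x y, R x y y x = - R x y x y := fun x y => h2 _ _ _ _
  have hc : ∀ x y, R y x y x = R x y x y := fun x y => by rw [h1, h2, neg_neg]
  simp [testForms, Fin.sum_univ_four, hz, hs]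
  rw [hc (e 0) (e 1), hc (e 0) (e 2), hc (e 0) (e 3), hc (e 1) (e 2), hc (e 1) (e 3),
    hc (e 2) (e 3)]
  ring

/-- If the curvature operator of the second kind of an algebraic curvature tensor on
an inner product space of dimension `n ≥ 4` is four-positive, then for every
orthonormal 4-tuple, `R₁₄₁₄ + R₂₃₂₃ > 0`. -/
theorem statement5 {V : Type*} [NormedAddCommGroup V] [InnerProductSpace ℝ V]
    [FiniteDimensional ℝ V] {n : ℕ} (hn : 4 ≤ n) (hdim : Module.finrank ℝ V = n)
    (R : V →ₗ[ℝ] V →ₗ[ℝ] V →ₗ[ℝ] V →ₗ[ℝ] ℝ)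
    (hR : IsAlgCurv R)
    (hpos : kPositiveSecondKind n 4 R) :
    ∀ e : Fin 4 → V, Orthonormal ℝ e →
      0 < R (e 0) (e 3) (e 0) (e 3) + R (e 1) (e 2) (e 1) (e 2) := by
  intro e he
  obtain ⟨b, hb⟩ := exists_orthonormalBasis_castLE hn hdim he
  have hf : Function.Injective (Fin.castLE hn) := Fin.castLE_injective hn
  have h := hpos b (fun a => pushMatrix (Fin.castLE hn) (testForms a))
    (fun a => isSymm_pushMatrix _ (by
      ext i j
      fin_cases a <;> fin_cases i <;> fin_cases j <;> simp [testForms]))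
    (fun a => by
      rw [trace_pushMatrix hf]
      fin_cases a <;> simp [testForms, Matrix.trace, Fin.sum_univ_four] <;> norm_num)
    (fun a => by
      rw [sum_pushMatrix_mul_pushMatrix hf]
      fin_cases a <;> simp [testForms, Fin.sum_univ_four, Matrix.diagonal_apply] <;> norm_num)
    (fun a a' haa' => by
      rw [sum_pushMatrix_mul_pushMatrix hf]
      fin_cases a <;> fin_cases a' <;>
        simp [testForms, Fin.sum_univ_four, Matrix.diagonal_apply] at haa' ⊢ <;> norm_num)
  simp only [secondKind_pushMatrix, hb, sum_testForms hR] at h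
  linarith
end
end

section
/- Let V be a 3-dimensional real inner product space and let R be an algebraic curvature tensor on V with R̂(h,h) ≥ 0 for every h ∈ S²₀(V). Then Ric ≥ (S/6)·g as bilinear forms: for every unit vector v ∈ V, Ric(v,v) ≥ S/6, where Ric(x,y) = Σ_k R(x,e_k,y,e_k) for any orthonormal basis (e₁,e₂,e₃) and S = Σ_i Ric(e_i,e_i) is the scalar curvature. -/
open scoped BigOperators

noncomputable section

/-- The curvature operator of the second kind on the symmetric tensor `g - t v ⊗ v`:
`R̂(g - t v ⊗ v, g - t v ⊗ v) = -S + 2 t Ric(v,v)`. -/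
theorem secondKind_one_sub_smul_vecMulVec {V : Type*} [NormedAddCommGroup V]
    [InnerProductSpace ℝ V] {n : ℕ} {R : V →ₗ[ℝ] V →ₗ[ℝ] V →ₗ[ℝ] V →ₗ[ℝ] ℝ}
    (hR : IsAlgCurv R) (b : OrthonormalBasis (Fin n) ℝ V) (v : V) (t : ℝ) :
    secondKind R b (1 - t • Matrix.vecMulVec (b.repr v) (b.repr v))
        (1 - t • Matrix.vecMulVec (b.repr v) (b.repr v)) =
      -(∑ i, ∑ k, R (b i) (b k) (b i) (b k)) + 2 * t * ∑ k, R v (b k) v (b k) := by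
  obtain ⟨h₁, h₂, -, -⟩ := hR
  have hv : v = ∑ i, b.repr v i • b i := (b.sum_repr v).symm
  obtain ⟨c, hc⟩ : ∃ c : Fin n → ℝ, c = b.repr v := ⟨_, rfl⟩
  rw [← hc] at hv ⊢
  have expand (x y : V) : R v x v y = ∑ i, ∑ j, c i * c j * R (b i) x (b j) y := by
    rw [hv]
    simp only [map_sum, map_smul, LinearMap.sum_apply, LinearMap.smul_apply, smul_eq_mul,
      Finset.mul_sum, mul_assoc]
    rw [Finset.sum_comm]
    exact Finset.sum_congr rfl fun i _ => Finset.sum_congr rfl fun j _ => by ring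
  have ric : ∑ k, R v (b k) v (b k) =
      -∑ i, ∑ j, ∑ k, c i * c j * R (b i) (b k) (b k) (b j) := by
    simp_rw [expand, ← Finset.sum_neg_distrib]
    rw [Finset.sum_comm]
    refine Finset.sum_congr rfl fun i _ => ?_
    rw [Finset.sum_comm]
    refine Finset.sum_congr rfl fun j _ => Finset.sum_congr rfl fun k _ => ?_
    rw [h₂]; ring
  have ric' : ∑ k, R v (b k) v (b k) =
      -∑ i, ∑ k, ∑ l, c k * c l * R (b i) (b k) (b l) (b i) := by
    simp_rw [expand, ← Finset.sum_neg_distrib]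
    refine Finset.sum_congr rfl fun i _ => Finset.sum_congr rfl fun j _ =>
      Finset.sum_congr rfl fun k _ => ?_
    rw [h₁]; ring
  have full : ∑ i, ∑ j, ∑ k, ∑ l, c i * c j * (c k * c l) * R (b i) (b k) (b l) (b j) = 0 := by
    have swap (i j : Fin n) : ∑ k, ∑ l, c i * c j * (c k * c l) * R (b i) (b k) (b l) (b j) =
        c i * c j * R (b i) v v (b j) := by
      rw [hv]
      simp only [map_sum, map_smul, LinearMap.sum_apply, LinearMap.smul_apply, smul_eq_mul,
        Finset.mul_sum, mul_assoc]
      rw [Finset.sum_comm]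
      exact Finset.sum_congr rfl fun k _ => Finset.sum_congr rfl fun l _ => by ring
    have key : ∑ i, ∑ j, c i * c j * R (b i) v v (b j) = -R v v v v := by
      rw [expand, ← Finset.sum_neg_distrib]
      refine Finset.sum_congr rfl fun i _ => ?_
      rw [← Finset.sum_neg_distrib]
      refine Finset.sum_congr rfl fun j _ => ?_
      rw [h₂]; ring
    simp_rw [swap, key]
    linarith [h₁ v v v v]
  have scal : ∑ i, ∑ k, R (b i) (b k) (b i) (b k) = -∑ i, ∑ k, R (b i) (b k) (b k) (b i) := by
    simp_rw [← Finset.sum_neg_distrib]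
    exact Finset.sum_congr rfl fun i _ => Finset.sum_congr rfl fun k _ => h₂ _ _ _ _
  have split : secondKind R b (1 - t • Matrix.vecMulVec c c) (1 - t • Matrix.vecMulVec c c) =
      (∑ i, ∑ k, R (b i) (b k) (b k) (b i))
        - t * (∑ i, ∑ j, ∑ k, c i * c j * R (b i) (b k) (b k) (b j))
        - t * (∑ i, ∑ k, ∑ l, c k * c l * R (b i) (b k) (b l) (b i))
        + t ^ 2 * ∑ i, ∑ j, ∑ k, ∑ l, c i * c j * (c k * c l) * R (b i) (b k) (b l) (b j) := by
    have term (i j k l : Fin n) : R (b i) (b k) (b l) (b j)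
          * (1 - t • Matrix.vecMulVec c c) k l * (1 - t • Matrix.vecMulVec c c) i j =
        (if i = j then if k = l then R (b i) (b k) (b l) (b j) else 0 else 0)
          - (if k = l then t * (c i * c j * R (b i) (b k) (b l) (b j)) else 0)
          - (if i = j then t * (c k * c l * R (b i) (b k) (b l) (b j)) else 0)
          + t ^ 2 * (c i * c j * (c k * c l) * R (b i) (b k) (b l) (b j)) := by
      simp only [Matrix.sub_apply, Matrix.smul_apply, Matrix.one_apply, Matrix.vecMulVec_apply,
        smul_eq_mul]
      split_ifs <;> ring
    simp only [secondKind, term, Finset.sum_add_distrib, Finset.sum_sub_distrib, Finset.mul_sum]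
    have collapse (f : Fin n → Fin n → Fin n → Fin n → ℝ) :
        ∑ i, ∑ j, ∑ k, ∑ l, (if i = j then f i j k l else 0) = ∑ i, ∑ k, ∑ l, f i i k l := by
      refine Finset.sum_congr rfl fun i _ => ?_
      rw [Finset.sum_eq_single i (by intro j _ h; simp [h.symm]) (by simp)]
      simp
    rw [collapse, collapse]
    simp only [Finset.sum_ite_eq, Finset.mem_univ, if_true]
  rw [split, full, scal]
  linear_combination (-t) * ric - t * ric'

/-- In dimension three, if the curvature operator of the second kind is
non-negative, then `Ric ≥ (S/6) g`: for every unit vector `v`,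
`Ric(v,v) ≥ S/6`. -/
theorem statement8 {V : Type*} [NormedAddCommGroup V] [InnerProductSpace ℝ V]
    [FiniteDimensional ℝ V] (hdim : Module.finrank ℝ V = 3)
    (R : V →ₗ[ℝ] V →ₗ[ℝ] V →ₗ[ℝ] V →ₗ[ℝ] ℝ)
    (hR : IsAlgCurv R)
    (hnn : ∀ (b : OrthonormalBasis (Fin 3) ℝ V) (h : Matrix (Fin 3) (Fin 3) ℝ),
      h.IsSymm → h.trace = 0 → 0 ≤ secondKind R b h h) :
    ∀ (b : OrthonormalBasis (Fin 3) ℝ V) (v : V), ‖v‖ = 1 →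
      (∑ i, ∑ k, R (b i) (b k) (b i) (b k)) / 6 ≤ ∑ k, R v (b k) v (b k) := by
  intro b v hv
  have hc : ∑ i, b.repr v i * b.repr v i = 1 := by
    have h := b.repr.norm_map v
    rw [hv, EuclideanSpace.norm_eq, Real.sqrt_eq_one] at h
    simpa [sq] using h
  have h := hnn b (1 - (3 : ℝ) • Matrix.vecMulVec (b.repr v) (b.repr v)) ?_ ?_
  · rw [secondKind_one_sub_smul_vecMulVec hR] at h
    linarith
  · ext i j
    simp [Matrix.vecMulVec_apply, Matrix.one_apply, eq_comm, mul_comm]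
  · rw [Matrix.trace_sub, Matrix.trace_smul, Matrix.trace_one, Matrix.trace_vecMulVec]
    simp [dotProduct, hc]
end
end

section
/- Let λ₁ ≤ λ₂ ≤ λ₃ and μ₁ ≤ μ₂ ≤ μ₃ be real numbers with λ₁ + λ₂ + λ₃ = 0 and μ₁ + μ₂ + μ₃ = 0. Suppose that for every subset P of {1,2,3}×{1,2,3} with exactly five elements, Σ_{(i,j)∈P} (1/3 − λ_i − μ_j) ≥ 0. Then λ₃ + μ₃ ≤ 5/6. -/
open scoped BigOperators

/-- If `λ₁ ≤ λ₂ ≤ λ₃` and `μ₁ ≤ μ₂ ≤ μ₃` each sum to zero and every sum of five of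
the nine numbers `1/3 − λ_i − μ_j` is non-negative, then `λ₃ + μ₃ ≤ 5/6`. -/
theorem statement16 (lam mu : Fin 3 → ℝ)
    (hlam12 : lam 0 ≤ lam 1) (hlam23 : lam 1 ≤ lam 2)
    (hmu12 : mu 0 ≤ mu 1) (hmu23 : mu 1 ≤ mu 2)
    (hlsum : lam 0 + lam 1 + lam 2 = 0) (hmsum : mu 0 + mu 1 + mu 2 = 0)
    (h5 : ∀ P : Finset (Fin 3 × Fin 3), P.card = 5 →
      0 ≤ ∑ p ∈ P, (1 / 3 - lam p.1 - mu p.2)) :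
    lam 2 + mu 2 ≤ 5 / 6 := by
  have h := h5 {(2, 0), (2, 1), (2, 2), (0, 2), (1, 2)} (by decide)
  simp at h
  linarith
end

section
/- Let a₁ ≤ a₂ ≤ a₃ and b₁, b₂, b₃ be real numbers with a₁ + a₂ + a₃ = 0 and b₁ + b₂ + b₃ = 0, set λ_i = a_i + b_i and μ_i = a_i − b_i, and assume λ₁ ≤ λ₂ ≤ λ₃ and μ₁ ≤ μ₂ ≤ μ₃. Suppose that for every subset P of {1,2,3}×{1,2,3} with exactly six elements, Σ_{(i,j)∈P} (1/3 − λ_i − μ_j) ≥ 0. Then λ₃ + μ₃ ≤ 4/3, λ₁ ≥ −2/3, and μ₁ ≥ −2/3; in particular 4/3 − λ₃ − μ₃ ≥ 0, 4/3 + λ₁ ≥ 0, and 4/3 + μ₁ ≥ 0. -/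
open scoped BigOperators

/-- Let `a₁ ≤ a₂ ≤ a₃` and `b₁, b₂, b₃` sum to zero, set `λ_i = a_i + b_i` and
`μ_i = a_i − b_i`, and assume `λ₁ ≤ λ₂ ≤ λ₃` and `μ₁ ≤ μ₂ ≤ μ₃`. If every sum of
six of the nine numbers `1/3 − λ_i − μ_j` is non-negative, then
`λ₃ + μ₃ ≤ 4/3`, `λ₁ ≥ −2/3` and `μ₁ ≥ −2/3`; in particular
`4/3 − λ₃ − μ₃ ≥ 0`, `4/3 + λ₁ ≥ 0` and `4/3 + μ₁ ≥ 0`. -/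
theorem statement17 (a b : Fin 3 → ℝ)
    (ha12 : a 0 ≤ a 1) (ha23 : a 1 ≤ a 2)
    (hasum : a 0 + a 1 + a 2 = 0) (hbsum : b 0 + b 1 + b 2 = 0)
    (lam mu : Fin 3 → ℝ)
    (hlam : ∀ i, lam i = a i + b i) (hmu : ∀ i, mu i = a i - b i)
    (hlam12 : lam 0 ≤ lam 1) (hlam23 : lam 1 ≤ lam 2)
    (hmu12 : mu 0 ≤ mu 1) (hmu23 : mu 1 ≤ mu 2)
    (h6 : ∀ P : Finset (Fin 3 × Fin 3), P.card = 6 →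
      0 ≤ ∑ p ∈ P, (1 / 3 - lam p.1 - mu p.2)) :
    lam 2 + mu 2 ≤ 4 / 3 ∧ -2 / 3 ≤ lam 0 ∧ -2 / 3 ≤ mu 0 ∧
    0 ≤ 4 / 3 - lam 2 - mu 2 ∧ 0 ≤ 4 / 3 + lam 0 ∧ 0 ≤ 4 / 3 + mu 0 := by
  have hlamsum : lam 0 + lam 1 + lam 2 = 0 := by
    linarith [hlam 0, hlam 1, hlam 2]
  have hmusum : mu 0 + mu 1 + mu 2 = 0 := by
    linarith [hmu 0, hmu 1, hmu 2]
  have hrow := h6 {(1, 0), (1, 1), (1, 2), (2, 0), (2, 1), (2, 2)} (by decide)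
  have hcol := h6 {(0, 1), (0, 2), (1, 1), (1, 2), (2, 1), (2, 2)} (by decide)
  have hcorner := h6 {(0, 2), (1, 1), (1, 2), (2, 0), (2, 1), (2, 2)} (by decide)
  simp [Finset.sum_insert] at hrow hcol hcorner
  refine ⟨?_, ?_, ?_, ?_, ?_, ?_⟩ <;> linarith
end
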